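/- arXiv:2407.09824 — 2 statements merged into one kernel-verified Lean document; each statement's English description precedes it below -/
import Mathlib

section
/- Fix a partition ν with no parts equal to 1 and fix positive integers k, n with n(ν)·k < n. Under the conjugacy measure μ_ψ on partitions λ of n, the k-th moment of the character-ratio random variable W_{n,ν}(λ) = [n]_{n(ν)} · χ^λ(ν) · √(d(ν)) / (f^λ · n^{n(ν)/2} · √(c(ν))) equals Σ_{δ ⊢ n} (c(δ)/n!) · B_{n,ν,k,δ} · (d(ν)c(ν)/n^{n(ν)})^{k/2}, where B_{n,ν,k,δ} is the number of k-tuples (g_1,...,g_k) of elements of S_n, each in the conjugacy class of cycle type ν, whose product lies in the conjugacy class of cycle type δ. -/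
open CategoryTheory Equiv

/-- `c(μ) = ∏_i l_i(μ)! · i^{l_i(μ)}` for a multiset `μ` of parts. -/
def cPart (mu : Multiset ℕ) : ℕ :=
  ∏ i ∈ mu.toFinset, Nat.factorial (mu.count i) * i ^ mu.count i

/-- `d(μ) = ∏_i l_i(μ)!` for a multiset `μ` of parts. -/
def dPart (mu : Multiset ℕ) : ℕ :=
  ∏ i ∈ mu.toFinset, Nat.factorial (mu.count i)

open scoped Finset

namespace FDRep

variable {G : Type} [Group G]

theorem finrank_invariants_linHom_self {K : Type} [Field K] [IsAlgClosed K] (V : FDRep K G)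
    [Simple V] : Module.finrank K (Representation.linHom V.ρ V.ρ).invariants = 1 := by
  rw [(Representation.linHom.invariantsEquivFDRepHom V V).finrank_eq,
    finrank_hom_simple_simple, if_pos ⟨Iso.refl V⟩]

/-- **Schur's lemma** for linear maps commuting with a simple representation. -/
theorem eq_smul_id_of_comm {K : Type} [Field K] [IsAlgClosed K] (V : FDRep K G) [Simple V]
    (T : V →ₗ[K] V) (hT : ∀ g, T ∘ₗ V.ρ g = V.ρ g ∘ₗ T) :
    ∃ c : K, T = c • LinearMap.id := by
  have h1 := V.finrank_invariants_linHom_self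
  have hcomm : ∀ S : V →ₗ[K] V, (∀ g, S ∘ₗ V.ρ g = V.ρ g ∘ₗ S) →
      S ∈ (Representation.linHom V.ρ V.ρ).invariants := by
    intro S hS g
    rw [Representation.linHom_apply, ← LinearMap.comp_assoc, ← hS, LinearMap.comp_assoc,
      ← Module.End.mul_eq_comp (V.ρ g), ← map_mul]
    simp [Module.End.one_eq_id]
  have hid : (⟨LinearMap.id, hcomm _ fun g => by simp⟩ :
      (Representation.linHom V.ρ V.ρ).invariants) ≠ 0 := by
    intro h
    have hzero : (LinearMap.id : V →ₗ[K] V) = 0 := congrArg Subtype.val h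
    have hall : ∀ x : (Representation.linHom V.ρ V.ρ).invariants, x = 0 := by
      intro x
      ext1
      rw [← LinearMap.comp_id x.1, hzero, LinearMap.comp_zero]
      rfl
    have : Subsingleton (Representation.linHom V.ρ V.ρ).invariants :=
      ⟨fun a b => (hall a).trans (hall b).symm⟩
    rw [Module.finrank_zero_of_subsingleton] at h1
    exact zero_ne_one h1
  obtain ⟨c, hc⟩ := (finrank_eq_one_iff_of_nonzero' _ hid).mp h1 ⟨T, hcomm T hT⟩
  exact ⟨c, (congrArg Subtype.val hc).symm⟩

theorem char_one_ne_zero {K : Type} [Field K] [CharZero K] [IsAlgClosed K]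
    (V : FDRep K G) [Simple V] : V.character 1 ≠ 0 := by
  rw [char_one]
  intro h
  have h0 : Module.finrank K V = 0 := by exact_mod_cast h
  have : Subsingleton V := Module.finrank_zero_iff.mp h0
  have h1 := V.finrank_invariants_linHom_self
  rw [Module.finrank_zero_of_subsingleton] at h1
  exact zero_ne_one h1

theorem char_eq_of_isConj {K : Type} [Field K] (V : FDRep K G) {g h : G} (hgh : IsConj g h) :
    V.character g = V.character h := by
  obtain ⟨c, rfl⟩ := isConj_iff.mp hgh
  exact (V.char_conj g c).symm

/-- The sum of a conjugation-invariant set acts on a simple representation as a scalar. -/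
theorem sum_char_mul_eq {K : Type} [Field K] [CharZero K] [IsAlgClosed K]
    (V : FDRep K G) [Simple V] (S : Finset G)
    (hS : ∀ g h, g ∈ S → h * g * h⁻¹ ∈ S) (h : G) :
    ∑ g ∈ S, V.character (g * h) =
      (∑ g ∈ S, V.character g) / V.character 1 * V.character h := by
  obtain ⟨c, hc⟩ := V.eq_smul_id_of_comm (∑ g ∈ S, V.ρ g) (by
    intro x
    simp only [← Module.End.mul_eq_comp, Finset.sum_mul, Finset.mul_sum, ← map_mul]
    refine Finset.sum_bij' (fun g _ => x⁻¹ * g * x) (fun g _ => x * g * x⁻¹) ?_ ?_ ?_ ?_ ?_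
    · intro g hg
      simpa using hS g x⁻¹ hg
    · intro g hg
      exact hS g x hg
    · intro g _
      group
    · intro g _
      group
    · intro g _
      congr 1
      group)
  have hmul : ∀ y, ∑ g ∈ S, V.character (g * y) = c * V.character y := by
    intro y
    simp only [character, map_mul, ← map_sum, ← Finset.sum_mul, hc, ← Module.End.one_eq_id]
    simp
  have hone := hmul 1
  simp only [mul_one] at hone
  rw [hmul h, hone, mul_div_cancel_right₀ _ V.char_one_ne_zero]

theorem sum_char_prod_eq {K : Type} [Field K] [CharZero K] [IsAlgClosed K]
    (V : FDRep K G) [Simple V] (S : Finset G)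
    (hS : ∀ g h, g ∈ S → h * g * h⁻¹ ∈ S) (k : ℕ) (h : G) :
    ∑ t ∈ Fintype.piFinset (fun _ : Fin k => S), V.character ((List.ofFn t).prod * h) =
      ((∑ g ∈ S, V.character g) / V.character 1) ^ k * V.character h := by
  induction k generalizing h with
  | zero => simp
  | succ k ih =>
    have hsplit : ∑ t ∈ Fintype.piFinset (fun _ : Fin (k + 1) => S),
          V.character ((List.ofFn t).prod * h) =
        ∑ p ∈ S ×ˢ Fintype.piFinset (fun _ : Fin k => S),
          V.character (p.1 * ((List.ofFn p.2).prod * h)) := by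
      refine Finset.sum_bij' (fun t _ => (t 0, Fin.tail t)) (fun p _ => Fin.cons p.1 p.2)
        ?_ ?_ ?_ ?_ ?_
      · intro t ht
        simp only [Fintype.mem_piFinset, Finset.mem_product] at ht ⊢
        exact ⟨ht 0, fun i => ht i.succ⟩
      · intro p hp
        simp only [Fintype.mem_piFinset, Finset.mem_product] at hp ⊢
        exact fun i => Fin.cases hp.1 hp.2 i
      · intro t _
        exact Fin.cons_self_tail t
      · intro p _
        simp
      · intro t _
        rw [List.ofFn_succ, List.prod_cons, mul_assoc]
        rfl
    rw [hsplit, Finset.sum_product_right]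
    simp only [sum_char_mul_eq V S hS]
    rw [← Finset.mul_sum, ih, pow_succ]
    ring

/-- **Column orthogonality** of the character table of a finite group, for a complete family of
irreducible representations. -/
theorem char_column_orthogonality {K : Type} [Field K] [CharZero K] [IsAlgClosed K] [Fintype G]
    [DecidableRel (IsConj : G → G → Prop)]
    {ι : Type} [Fintype ι] (e : ι ≃ ConjClasses G) (V : ι → FDRep K G)
    (hsimple : ∀ i, Simple (V i)) (hiso : ∀ i j, Nonempty (V i ≅ V j) → i = j) (g h : G) :
    (#{x : G | IsConj h x} : K) * ∑ i, (V i).character h⁻¹ * (V i).character g =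
      if IsConj g h then (Nat.card G : K) else 0 := by
  classical
  have hG : (Nat.card G : K) ≠ 0 := by exact_mod_cast Nat.card_pos.ne'
  let : Invertible (Nat.card G : K) := invertibleOfNonzero hG
  let A : Matrix ι (ConjClasses G) K := fun i C => (V i).character C.out
  let B : Matrix (ConjClasses G) ι K := fun C j =>
    (Nat.card G : K)⁻¹ * ((#{x : G | ConjClasses.mk x = C} : K) * (V j).character C.out⁻¹)
  have hout : ∀ x : G, IsConj (ConjClasses.mk x).out x := fun x =>
    ConjClasses.mk_eq_mk_iff_isConj.mp (Quotient.out_eq (ConjClasses.mk x))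
  have hinv : ∀ {x y : G}, IsConj x y → IsConj x⁻¹ y⁻¹ := by
    intro x y hxy
    obtain ⟨c, rfl⟩ := isConj_iff.mp hxy
    exact isConj_iff.mpr ⟨c, by group⟩
  have hAB : A * B = 1 := by
    ext i j
    have := hsimple i
    have := hsimple j
    have horth := char_orthonormal (V i) (V j)
    rw [← Finset.sum_fiberwise Finset.univ ConjClasses.mk, Finset.mul_sum] at horth
    rw [Matrix.mul_apply, Matrix.one_apply]
    trans (if Nonempty (V i ≅ V j) then 1 else 0 : K)
    · rw [← horth]
      refine Finset.sum_congr rfl fun C _ => ?_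
      rw [Finset.sum_congr rfl (g := fun _ => A i C * (V j).character C.out⁻¹),
        Finset.sum_const, nsmul_eq_mul]
      · simp only [B]
        ring
      · intro x hx
        obtain rfl := (Finset.mem_filter.mp hx).2
        change _ = (V i).character (ConjClasses.mk x).out * _
        rw [(V i).char_eq_of_isConj (hout x), (V j).char_eq_of_isConj (hinv (hout x))]
    · refine if_congr ⟨hiso i j, ?_⟩ rfl rfl
      rintro rfl
      exact ⟨Iso.refl _⟩
  have hBA : B * A = 1 := (Matrix.mul_eq_one_comm_of_equiv e).mp hAB
  have hentry := congrFun (congrFun hBA (ConjClasses.mk h)) (ConjClasses.mk g)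
  rw [Matrix.mul_apply, Matrix.one_apply] at hentry
  have hterm : ∀ i, B (ConjClasses.mk h) i * A i (ConjClasses.mk g) = (Nat.card G : K)⁻¹ *
      ((#{x : G | IsConj h x} : K) * ((V i).character h⁻¹ * (V i).character g)) := by
    intro i
    change (Nat.card G : K)⁻¹ * ((#{x : G | ConjClasses.mk x = ConjClasses.mk h} : K) *
      (V i).character (ConjClasses.mk h).out⁻¹) * (V i).character (ConjClasses.mk g).out = _
    rw [(V i).char_eq_of_isConj (hout g), (V i).char_eq_of_isConj (hinv (hout h))]
    simp only [ConjClasses.mk_eq_mk_iff_isConj, isConj_comm (h := h)]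
    ring
  simp only [hterm, ← Finset.mul_sum] at hentry
  rw [inv_mul_eq_iff_eq_mul₀ hG] at hentry
  rw [hentry]
  simp only [ConjClasses.mk_eq_mk_iff_isConj, isConj_comm (g := h)]
  split_ifs <;> simp

end FDRep

section CycleType

theorem cPart_eq_prod_of_subset {m : Multiset ℕ} {s : Finset ℕ} (hs : m.toFinset ⊆ s) :
    cPart m = ∏ i ∈ s, Nat.factorial (m.count i) * i ^ m.count i := by
  refine Finset.prod_subset hs fun i _ hi => ?_
  rw [Multiset.count_eq_zero.mpr (by simpa using hi)]
  simp

theorem cPart_eq_prod_mul (m : Multiset ℕ) :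
    cPart m = m.prod * ∏ i ∈ m.toFinset, Nat.factorial (m.count i) := by
  rw [cPart, Finset.prod_mul_distrib, Finset.prod_multiset_count, mul_comm]

theorem cPart_add_replicate_one {m : Multiset ℕ} (hm : 1 ∉ m) (a : ℕ) :
    cPart (m + Multiset.replicate a 1) = Nat.factorial a * cPart m := by
  have hs : (m + Multiset.replicate a 1).toFinset ⊆ insert 1 m.toFinset := by
    intro i hi
    rw [Multiset.mem_toFinset, Multiset.mem_add] at hi
    rcases hi with hi | hi
    · exact Finset.mem_insert_of_mem (Multiset.mem_toFinset.mpr hi)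
    · rw [Multiset.eq_of_mem_replicate hi]
      exact Finset.mem_insert_self _ _
  have hm' : 1 ∉ m.toFinset := by simpa using hm
  rw [cPart_eq_prod_of_subset hs, Finset.prod_insert hm', cPart]
  congr 1
  · simp [Multiset.count_eq_zero.mpr hm]
  · refine Finset.prod_congr rfl fun i hi => ?_
    have : i ≠ 1 := fun h => hm' (h ▸ hi)
    rw [Multiset.count_add, Multiset.count_replicate, if_neg this.symm, add_zero]

theorem cPart_pos {m : Multiset ℕ} (hm : 0 ∉ m) : 0 < cPart m := by
  refine Finset.prod_pos fun i hi => ?_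
  have : 0 < i := Nat.pos_of_ne_zero fun h => hm (h ▸ Multiset.mem_toFinset.mp hi)
  positivity

theorem Multiset.two_le_of_mem {m : Multiset ℕ} (h0 : 0 ∉ m) (h1 : 1 ∉ m) :
    ∀ a ∈ m, 2 ≤ a := by
  intro a ha
  have h : a ≠ 0 := fun h => h0 (h ▸ ha)
  have h' : a ≠ 1 := fun h => h1 (h ▸ ha)
  lia

theorem card_cycleType_mul_cPart {n : ℕ} {m : Multiset ℕ} (h0 : 0 ∉ m) (h1 : 1 ∉ m)
    (hm : m.sum ≤ n) :
    #{g : Perm (Fin n) | g.cycleType = m} * (Nat.factorial (n - m.sum) * cPart m) =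
      Nat.factorial n := by
  have h := Equiv.Perm.card_of_cycleType_mul_eq (Fin n) m
  rw [Fintype.card_fin, if_pos ⟨hm, Multiset.two_le_of_mem h0 h1⟩] at h
  rw [← h, cPart_eq_prod_mul, mul_assoc (Nat.factorial _)]

namespace Nat.Partition

variable {n : ℕ}

theorem zero_notMem_parts (δ : n.Partition) : 0 ∉ δ.parts :=
  fun h => (δ.parts_pos h).ne rfl

theorem parts_eq_filter_add (δ : n.Partition) :
    δ.parts = δ.parts.filter (fun i => i ≠ 1) +
      Multiset.replicate (n - (δ.parts.filter (fun i => i ≠ 1)).sum) 1 := by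
  have h := Multiset.filter_add_not (fun i => i ≠ 1) δ.parts
  have h1 : δ.parts.filter (fun i => ¬ i ≠ 1) = Multiset.replicate (δ.parts.count 1) 1 := by
    simp only [not_not]
    exact Multiset.filter_eq' _ _
  rw [h1] at h
  have hsum := congrArg Multiset.sum h
  rw [Multiset.sum_add, Multiset.sum_replicate, δ.parts_sum, smul_eq_mul, mul_one] at hsum
  conv_lhs => rw [← h]
  congr 2
  lia

theorem sum_filter_le (δ : n.Partition) : (δ.parts.filter (fun i => i ≠ 1)).sum ≤ n := by
  have h := congrArg Multiset.sum (Multiset.filter_add_not (fun i => i ≠ 1) δ.parts)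
  rw [Multiset.sum_add, δ.parts_sum] at h
  lia

theorem filter_ne_one_injective :
    Function.Injective fun δ : n.Partition => δ.parts.filter (fun i => i ≠ 1) := by
  intro δ ε h
  simp only at h
  ext1
  rw [δ.parts_eq_filter_add, ε.parts_eq_filter_add, h]

theorem card_cycleType_mul_cPart (δ : n.Partition) :
    #{g : Perm (Fin n) | g.cycleType = δ.parts.filter (fun i => i ≠ 1)} * cPart δ.parts =
      Nat.factorial n := by
  have h1 : 1 ∉ δ.parts.filter (fun i => i ≠ 1) := by simp
  have h0 : 0 ∉ δ.parts.filter (fun i => i ≠ 1) :=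
    fun h => δ.zero_notMem_parts (Multiset.mem_of_mem_filter h)
  rw [← _root_.card_cycleType_mul_cPart h0 h1 δ.sum_filter_le, ← cPart_add_replicate_one h1,
    ← δ.parts_eq_filter_add]

end Nat.Partition

/-- The partition of `n` formed by the cycle lengths of a permutation, fixed points included. -/
def fullCycleType {n : ℕ} (σ : Perm (Fin n)) : n.Partition where
  parts := σ.partition.parts
  parts_pos := σ.partition.parts_pos
  parts_sum := σ.partition.parts_sum.trans (Fintype.card_fin n)

theorem filter_fullCycleType {n : ℕ} (σ : Perm (Fin n)) :
    (fullCycleType σ).parts.filter (fun i => i ≠ 1) = σ.cycleType := by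
  rw [← Equiv.Perm.filter_parts_partition_eq_cycleType]
  refine Multiset.filter_congr fun i hi => ?_
  have := (fullCycleType σ).parts_pos hi
  lia

theorem fullCycleType_eq_iff {n : ℕ} {σ : Perm (Fin n)} {δ : n.Partition} :
    fullCycleType σ = δ ↔ σ.cycleType = δ.parts.filter (fun i => i ≠ 1) := by
  rw [← filter_fullCycleType]
  exact Nat.Partition.filter_ne_one_injective.eq_iff.symm

theorem isConj_iff_fullCycleType_eq {n : ℕ} {σ τ : Perm (Fin n)} :
    IsConj σ τ ↔ fullCycleType σ = fullCycleType τ := by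
  rw [Equiv.Perm.isConj_iff_cycleType_eq, fullCycleType_eq_iff, filter_fullCycleType]

theorem fullCycleType_surjective {n : ℕ} :
    Function.Surjective (fullCycleType : Perm (Fin n) → n.Partition) := by
  intro δ
  have h0 : 0 ∉ δ.parts.filter (fun i => i ≠ 1) :=
    fun h => δ.zero_notMem_parts (Multiset.mem_of_mem_filter h)
  obtain ⟨σ, hσ⟩ := (Equiv.Perm.exists_with_cycleType_iff (Fin n)
    (m := δ.parts.filter (fun i => i ≠ 1))).mpr
    ⟨by simpa using δ.sum_filter_le, Multiset.two_le_of_mem h0 (by simp)⟩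
  exact ⟨σ, fullCycleType_eq_iff.mpr hσ⟩

/-- Conjugacy classes of `S_n` correspond to partitions of `n`. -/
noncomputable def conjClassesEquivPartition (n : ℕ) :
    ConjClasses (Perm (Fin n)) ≃ n.Partition :=
  Equiv.ofBijective
    (Quotient.lift fullCycleType fun _ _ h => isConj_iff_fullCycleType_eq.mp h) <| by
    constructor
    · rintro ⟨σ⟩ ⟨τ⟩ h
      exact ConjClasses.mk_eq_mk_iff_isConj.mpr (isConj_iff_fullCycleType_eq.mpr h)
    · intro δ
      obtain ⟨σ, hσ⟩ := fullCycleType_surjective δ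
      exact ⟨ConjClasses.mk σ, hσ⟩

end CycleType

theorem sum_sum_char_mul_char {n : ℕ} (V : n.Partition → FDRep ℂ (Perm (Fin n)))
    (hsimple : ∀ lam, Simple (V lam))
    (hiso : ∀ lam mu, Nonempty (V lam ≅ V mu) → lam = mu) (g : Perm (Fin n)) :
    ∑ lam, (∑ᶠ C : ConjClasses (Perm (Fin n)), (V lam).character C.out) * (V lam).character g =
      cPart (fullCycleType g).parts := by
  classical
  let : Fintype (ConjClasses (Perm (Fin n))) := Fintype.ofFinite _
  simp only [finsum_eq_sum_of_fintype, Finset.sum_mul]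
  rw [Finset.sum_comm]
  have horth : ∀ h : Perm (Fin n), (#{x | IsConj h x} : ℂ) *
      ∑ lam, (V lam).character h * (V lam).character g =
        if IsConj g h then (Nat.factorial n : ℂ) else 0 := by
    intro h
    have hh : IsConj h h⁻¹ := by
      rw [Equiv.Perm.isConj_iff_cycleType_eq, Equiv.Perm.cycleType_inv]
    have := FDRep.char_column_orthogonality (conjClassesEquivPartition n).symm V hsimple hiso g h
    rw [Nat.card_perm, Nat.card_eq_fintype_card, Fintype.card_fin] at this
    simp only [← (V _).char_eq_of_isConj hh] at this
    exact this
  have hpos : ∀ h : Perm (Fin n), (#{x | IsConj h x} : ℂ) ≠ 0 := by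
    intro h
    have hmem := Finset.mem_filter.mpr ⟨Finset.mem_univ h, IsConj.refl h⟩
    exact_mod_cast (Finset.card_pos.mpr ⟨h, hmem⟩).ne'
  have hout : IsConj g (ConjClasses.mk g).out :=
    ConjClasses.mk_eq_mk_iff_isConj.mp (Quotient.out_eq (ConjClasses.mk g)).symm
  rw [Finset.sum_eq_single (ConjClasses.mk g)]
  · refine mul_left_cancel₀ (hpos (ConjClasses.mk g).out) ?_
    rw [horth, if_pos hout, ← (fullCycleType g).card_cycleType_mul_cPart, Nat.cast_mul]
    congr 4
    ext x
    rw [filter_fullCycleType, eq_comm, ← Equiv.Perm.isConj_iff_cycleType_eq]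
    exact ⟨fun hx => hout.symm.trans hx, fun hx => hout.trans hx⟩
  · intro C _ hC
    refine (mul_eq_zero.mp ?_).resolve_left (hpos C.out)
    rw [horth, if_neg]
    intro hg
    exact hC ((Quotient.out_eq C).symm.trans (ConjClasses.mk_eq_mk_iff_isConj.mpr hg.symm))
  · simp

theorem descFactorial_ratio_eq (n M a c : ℕ) (d : ℝ) (hn : 0 < n) (hc : 0 < c)
    (hac : n.descFactorial M = a * c) (hd : 0 ≤ d) (x f : ℂ) :
    ((n.descFactorial M : ℂ) * x * ((Real.sqrt d : ℝ) : ℂ)) /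
        (f * ((Real.sqrt ((n : ℝ) ^ M) : ℝ) : ℂ) * ((Real.sqrt c : ℝ) : ℂ)) =
      (a * x) / f * ((Real.sqrt (d * c / (n : ℝ) ^ M) : ℝ) : ℂ) := by
  have hc' : (0 : ℝ) < c := by exact_mod_cast hc
  have hn' : (0 : ℝ) < (n : ℝ) ^ M := by positivity
  have hs : ((Real.sqrt c : ℝ) : ℂ) ≠ 0 := by
    exact_mod_cast (Real.sqrt_pos.mpr hc').ne'
  have hsn : ((Real.sqrt ((n : ℝ) ^ M) : ℝ) : ℂ) ≠ 0 := by
    exact_mod_cast (Real.sqrt_pos.mpr hn').ne'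
  have hsc : (c : ℂ) = ((Real.sqrt c : ℝ) : ℂ) * ((Real.sqrt c : ℝ) : ℂ) := by
    rw [← Complex.ofReal_mul, Real.mul_self_sqrt hc'.le, Complex.ofReal_natCast]
  rw [hac, Nat.cast_mul, Real.sqrt_div (by positivity), Real.sqrt_mul hd, Complex.ofReal_div,
    Complex.ofReal_mul, hsc]
  rcases eq_or_ne f 0 with rfl | hf
  · simp
  · field_simp

/-- The `k`-th moment, under the conjugacy measure
`μ_ψ(λ) = f^λ (Σ_C χ^λ(C))/n!` on partitions `λ` of `n`, of the character-ratio
random variable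
`W_{n,ν}(λ) = [n]_{n(ν)} χ^λ(ν) √(d(ν)) / (f^λ n^{n(ν)/2} √(c(ν)))`
equals `Σ_{δ ⊢ n} (c(δ)/n!) · B_{n,ν,k,δ} · (d(ν)c(ν)/n^{n(ν)})^{k/2}`, where
`B_{n,ν,k,δ}` counts `k`-tuples of elements of `S_n` of cycle type `ν` whose
product has cycle type `δ`.  The irreducible representations of `S_n` are given
by a family of pairwise non-isomorphic irreducibles indexed by partitions of
`n`, and `χ^λ(ν)` is the character value at a fixed permutation `gν` of cycle
type `ν` (extended by fixed points). -/
theorem conjugacy_measure_moment_formula (n M k : ℕ) (hk : 0 < k)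
    (ν : Nat.Partition M) (hν : 1 ∉ ν.parts) (hM : M * k < n)
    (V : Nat.Partition n → FDRep ℂ (Perm (Fin n)))
    (hsimple : ∀ lam, Simple (V lam))
    (hiso : ∀ lam mu, Nonempty (V lam ≅ V mu) → lam = mu)
    (gν : Perm (Fin n)) (hg : gν.cycleType = ν.parts) :
    ∑ᶠ lam : Nat.Partition n,
      ((V lam).character 1 *
          (∑ᶠ C : ConjClasses (Perm (Fin n)), (V lam).character (Quotient.out C)) /
          (Nat.factorial n : ℂ)) *
        (((n.descFactorial M : ℂ) * (V lam).character gν *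
            ((Real.sqrt (dPart ν.parts) : ℝ) : ℂ)) /
          ((V lam).character 1 * ((Real.sqrt ((n : ℝ) ^ M) : ℝ) : ℂ) *
            ((Real.sqrt (cPart ν.parts) : ℝ) : ℂ))) ^ k =
    ∑ᶠ δ : Nat.Partition n,
      ((cPart δ.parts : ℂ) / (Nat.factorial n : ℂ)) *
        (Nat.card {t : Fin k → Perm (Fin n) //
            (∀ j, (t j).cycleType = ν.parts) ∧
            (List.ofFn t).prod.cycleType = δ.parts.filter (fun i => i ≠ 1)} : ℂ) *
        ((Real.sqrt (((dPart ν.parts : ℝ) * (cPart ν.parts : ℝ)) / (n : ℝ) ^ M) : ℝ) : ℂ) ^ k := by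
  classical
  have hn : 0 < n := by lia
  have hMn : M ≤ n := (Nat.le_mul_of_pos_right M hk).trans hM.le
  set S : Finset (Perm (Fin n)) := {g | g.cycleType = ν.parts} with hS
  set r : ℂ := ((Real.sqrt (((dPart ν.parts : ℝ) * (cPart ν.parts : ℝ)) / (n : ℝ) ^ M) : ℝ) : ℂ)
  have hSconj : ∀ g h, g ∈ S → h * g * h⁻¹ ∈ S := by
    intro g h hg
    simpa [hS, Equiv.Perm.cycleType_conj] using hg
  have hcard : n.descFactorial M = #S * cPart ν.parts := by
    have h := card_cycleType_mul_cPart (n := n) ν.zero_notMem_parts hν (ν.parts_sum.trans_le hMn)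
    rw [ν.parts_sum, mul_left_comm, ← Nat.factorial_mul_descFactorial hMn] at h
    exact (Nat.eq_of_mul_eq_mul_left (Nat.factorial_pos _) h).symm
  have hterm : ∀ lam : n.Partition,
      ((V lam).character 1 *
          (∑ᶠ C : ConjClasses (Perm (Fin n)), (V lam).character (Quotient.out C)) /
          (Nat.factorial n : ℂ)) *
        (((n.descFactorial M : ℂ) * (V lam).character gν *
            ((Real.sqrt (dPart ν.parts) : ℝ) : ℂ)) /
          ((V lam).character 1 * ((Real.sqrt ((n : ℝ) ^ M) : ℝ) : ℂ) *
            ((Real.sqrt (cPart ν.parts) : ℝ) : ℂ))) ^ k =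
      ∑ t ∈ Fintype.piFinset (fun _ : Fin k => S), r ^ k / (Nat.factorial n : ℂ) *
        ((∑ᶠ C : ConjClasses (Perm (Fin n)), (V lam).character (Quotient.out C)) *
          (V lam).character (List.ofFn t).prod) := by
    intro lam
    have := hsimple lam
    have hsum : ∑ g ∈ S, (V lam).character g = #S * (V lam).character gν := by
      rw [Finset.sum_congr rfl (g := fun _ => (V lam).character gν), Finset.sum_const,
        nsmul_eq_mul]
      intro g hgS
      refine (V lam).char_eq_of_isConj (Equiv.Perm.isConj_iff_cycleType_eq.mpr ?_)
      rw [hg, (Finset.mem_filter.mp hgS).2]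
    have hprod := (V lam).sum_char_prod_eq S hSconj k 1
    simp only [mul_one] at hprod
    rw [descFactorial_ratio_eq n M _ _ _ hn (cPart_pos ν.zero_notMem_parts) hcard
      (Nat.cast_nonneg _), ← hsum, ← Finset.mul_sum, ← Finset.mul_sum, hprod, mul_pow]
    ring
  rw [finsum_eq_sum_of_fintype, finsum_eq_sum_of_fintype,
    Finset.sum_congr rfl fun lam _ => hterm lam, Finset.sum_comm]
  simp only [← Finset.mul_sum, sum_sum_char_mul_char V hsimple hiso]
  rw [← Finset.sum_fiberwise (Fintype.piFinset fun _ : Fin k => S)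
    (fun t => fullCycleType (List.ofFn t).prod), Finset.mul_sum]
  refine Finset.sum_congr rfl fun δ _ => ?_
  rw [Finset.sum_congr rfl (g := fun _ => (cPart δ.parts : ℂ)) (by
    intro t ht
    rw [(Finset.mem_filter.mp ht).2]), Finset.sum_const, nsmul_eq_mul]
  have hcount : Nat.card {t : Fin k → Perm (Fin n) //
      (∀ j, (t j).cycleType = ν.parts) ∧
      (List.ofFn t).prod.cycleType = δ.parts.filter (fun i => i ≠ 1)} =
      #{t ∈ Fintype.piFinset (fun _ : Fin k => S) | fullCycleType (List.ofFn t).prod = δ} := by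
    rw [Nat.card_eq_fintype_card, Fintype.card_subtype]
    congr 1
    ext t
    simp [hS, fullCycleType_eq_iff]
  rw [hcount]
  ring
end

section
/- Fix q ≥ 2 and an even k = 2m. Let B_n denote the number of 2m-tuples of q-cycles in S_n whose product is the identity. Then lim_{n→∞} B_n · (q/n^q)^m = (2m−1)!!. -/
open Finset

theorem prod_apply_eq_self_of_forall {α : Type*} {y : α} {l : List (Equiv.Perm α)}
    (h : ∀ g ∈ l, g y = y) : l.prod y = y := by
  have : l.prod ∈ MulAction.stabilizer (Equiv.Perm α) y :=
    Subgroup.list_prod_mem _ fun g hg => by simpa using h g hg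
  simpa using this

/-- If a cycle `g` agrees on its support with the product of a list of permutations, and each
point of the support of `g` is moved by at most one entry, then a single entry agrees with `g`. -/
theorem exists_mem_eqOn_support_of_prod {α : Type*} [Fintype α] [DecidableEq α]
    {g : Equiv.Perm α} (hg : g.IsCycle) (R : List (Equiv.Perm α))
    (hprod : ∀ x ∈ g.support, R.prod x = g x)
    (hcount : ∀ x ∈ g.support, R.countP (fun r => r x ≠ x) ≤ 1) :
    ∃ r ∈ R, ∀ x ∈ g.support, r x = g x := by
  induction R with
  | nil =>
    obtain ⟨x, hx, -⟩ := hg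
    have h := hprod x (Equiv.Perm.mem_support.2 hx)
    simp at h
    exact absurd h.symm hx
  | cons r R ih =>
    by_cases hr : ∃ x ∈ g.support, r x ≠ x
    · obtain ⟨x, hxg, hxr⟩ := hr
      have key : ∀ y ∈ g.support, r y ≠ y → r y = g y := by
        intro y hy hry
        have hc := hcount y hy
        rw [List.countP_cons_of_pos (by simpa using hry)] at hc
        have hc0 : R.countP (fun r => r y ≠ y) = 0 := by omega
        rw [List.countP_eq_zero] at hc0
        have hfix : R.prod y = y :=
          prod_apply_eq_self_of_forall fun s hs => by simpa using hc0 s hs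
        have := hprod y hy
        rwa [List.prod_cons, Equiv.Perm.mul_apply, hfix] at this
      have step : ∀ n : ℕ, r ((g ^ n) x) ≠ (g ^ n) x := by
        intro n
        induction n with
        | zero => simpa using hxr
        | succ n ihn =>
          have hmem : (g ^ n) x ∈ g.support := Equiv.Perm.pow_apply_mem_support.2 hxg
          rw [pow_succ', Equiv.Perm.mul_apply, ← key _ hmem ihn]
          exact fun h => ihn (r.injective h)
      refine ⟨r, List.mem_cons_self, fun y hy => key y hy ?_⟩
      obtain ⟨n, rfl⟩ := hg.exists_pow_eq (Equiv.Perm.mem_support.1 hxg)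
        (Equiv.Perm.mem_support.1 hy)
      exact step n
    · push Not at hr
      obtain ⟨s, hs, h⟩ := ih (fun x hx => by
          have hgx := hr _ (Equiv.Perm.apply_mem_support.2 hx)
          have := hprod x hx
          rw [List.prod_cons, Equiv.Perm.mul_apply] at this
          exact r.injective (this.trans hgx.symm))
        (fun x hx => (List.countP_cons_of_neg (by simpa using hr x hx)).symm.trans_le
          (hcount x hx))
      exact ⟨s, List.mem_cons_of_mem _ hs, h⟩

/-- Lists of `2 * m` cycles of length `q` with supports in `A` and product `1`, no point being
moved by more than two entries. -/
def sparseCycleLists {α : Type*} [Fintype α] [DecidableEq α] (q m : ℕ) (A : Finset α) :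
    Set (List (Equiv.Perm α)) :=
  {l | l.length = 2 * m ∧ (∀ g ∈ l, (g.IsCycle ∧ #g.support = q) ∧ g.support ⊆ A) ∧
    l.prod = 1 ∧ ∀ x, l.countP (fun g => g x ≠ x) ≤ 2}

section

variable {α : Type*} [Fintype α] [DecidableEq α] {q m : ℕ} {A : Finset α}

theorem insert_pair_mem_sparseCycleLists {c : Equiv.Perm α} {T D : List (Equiv.Perm α)}
    (hc : c.IsCycle ∧ #c.support = q) (hcA : c.support ⊆ A)
    (hl : T ++ D ∈ sparseCycleLists q m (A \ c.support)) :
    c :: (T ++ c⁻¹ :: D) ∈ sparseCycleLists q (m + 1) A := by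
  obtain ⟨hlen, hcyc, hprod, hcount⟩ := hl
  refine ⟨by simp at hlen ⊢; omega, ?_, ?_, ?_⟩
  · have hc' : ((c⁻¹).IsCycle ∧ #(c⁻¹).support = q) ∧ (c⁻¹).support ⊆ A := by
      simpa using ⟨hc, hcA⟩
    have h : ∀ g ∈ T ++ D, (g.IsCycle ∧ #g.support = q) ∧ g.support ⊆ A :=
      fun g hg => ⟨(hcyc g hg).1, (hcyc g hg).2.trans sdiff_subset⟩
    intro g hg
    simp only [List.mem_cons, List.mem_append] at hg h
    rcases hg with rfl | hg | rfl | hg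
    · exact ⟨hc, hcA⟩
    · exact h g (.inl hg)
    · exact hc'
    · exact h g (.inr hg)
  · have hdisj : c.Disjoint T.prod := Equiv.Perm.disjoint_prod_right _ fun g hg => by
      rw [Equiv.Perm.disjoint_iff_disjoint_support]
      exact (disjoint_sdiff_self_left.mono_left
        (hcyc g (List.mem_append_left _ hg)).2).symm
    rw [List.prod_cons, List.prod_append, List.prod_cons, ← mul_assoc, hdisj.commute.eq]
    rw [List.prod_append] at hprod
    simpa [mul_assoc] using hprod
  · intro x
    have hx := hcount x
    simp only [List.countP_append, List.countP_cons] at hx ⊢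
    by_cases hcx : c x = x
    · simpa [hcx, Equiv.symm_apply_eq] using hx
    · have h0 : (T ++ D).countP (fun g => g x ≠ x) = 0 := by
        rw [List.countP_eq_zero]
        intro g hg
        have := (hcyc g hg).2
        by_contra hgx
        have := this (Equiv.Perm.mem_support.2 (by simpa using hgx))
        simp [hcx] at this
      rw [List.countP_append] at h0
      split_ifs <;> omega

theorem exists_pair_of_mem_sparseCycleLists {c : Equiv.Perm α} {R : List (Equiv.Perm α)}
    (hl : c :: R ∈ sparseCycleLists q (m + 1) A) :
    ∃ T D, R = T ++ c⁻¹ :: D ∧ T ++ D ∈ sparseCycleLists q m (A \ c.support) := by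
  obtain ⟨hlen, hcyc, hprod, hcount⟩ := hl
  have hc := hcyc c List.mem_cons_self
  have hR : R.prod = c⁻¹ := by
    rw [List.prod_cons] at hprod
    exact (inv_eq_of_mul_eq_one_right hprod).symm
  have hcountR : ∀ x ∈ c.support, R.countP (fun g => g x ≠ x) ≤ 1 := by
    intro x hx
    have := hcount x
    rw [List.countP_cons_of_pos (by simpa using hx)] at this
    omega
  obtain ⟨r, hr, hrc⟩ := exists_mem_eqOn_support_of_prod hc.1.1.inv R (by simp [hR])
    (by simpa using hcountR)
  have hr' := hcyc r (List.mem_cons_of_mem _ hr)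
  have hrc' : c⁻¹ = r := hc.1.1.inv.support_congr hr'.1.1 (fun x hx => by
      have := hrc x hx
      rw [Equiv.Perm.mem_support] at hx ⊢
      rwa [this]) fun x hx => (hrc x hx).symm
  subst hrc'
  obtain ⟨T, D, rfl⟩ := List.append_of_mem hr
  have hzero : ∀ x ∈ c.support, (T ++ D).countP (fun g => g x ≠ x) = 0 := by
    intro x hx
    have := hcountR x hx
    rw [List.countP_append, List.countP_cons_of_pos (by
      have hx' : x ∈ (c⁻¹).support := by rwa [Equiv.Perm.support_inv]
      exact decide_eq_true (Equiv.Perm.mem_support.1 hx'))] at this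
    rw [List.countP_append]
    omega
  have hsupp : ∀ g ∈ T ++ D, Disjoint g.support c.support := by
    intro g hg
    rw [disjoint_left]
    intro x hxg hxc
    have := List.countP_eq_zero.1 (hzero x hxc) g hg
    simp at this hxg
    exact hxg this
  refine ⟨T, D, rfl, by simp at hlen ⊢; omega, ?_, ?_, ?_⟩
  · intro g hg
    have hg' := hcyc g (by simp at hg ⊢; tauto)
    exact ⟨hg'.1, subset_sdiff.2 ⟨hg'.2, hsupp g hg⟩⟩
  · have hdisj : c.Disjoint T.prod := Equiv.Perm.disjoint_prod_right _ fun g hg => by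
      rw [Equiv.Perm.disjoint_iff_disjoint_support]
      exact (hsupp g (List.mem_append_left _ hg)).symm
    rw [List.prod_cons, List.prod_append, List.prod_cons, ← mul_assoc, hdisj.commute.eq] at hprod
    rw [List.prod_append]
    simpa [mul_assoc] using hprod
  · intro x
    have hx := hcount x
    simp only [List.countP_append, List.countP_cons] at hx ⊢
    omega

end

section

variable {α : Type*} [Fintype α] [DecidableEq α]

/-- Permutations of `A` correspond to permutations of the ambient type supported in `A`. -/
def permEquivSupportSubset (A : Finset α) :
    Equiv.Perm A ≃ {g : Equiv.Perm α // g.support ⊆ A} :=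
  (Equiv.Perm.subtypeEquivSubtypePerm (· ∈ A)).trans
    (Equiv.subtypeEquivRight fun g => by
      simp only [subset_iff, Equiv.Perm.mem_support]
      exact forall_congr' fun x => not_imp_comm)

theorem card_perm_support_subset (A : Finset α) :
    #{g : Equiv.Perm α | g.support ⊆ A} = (#A).factorial := by
  rw [← Fintype.card_subtype, ← Fintype.card_congr (permEquivSupportSubset A),
    Fintype.card_perm, Fintype.card_coe]

theorem isCycle_and_card_support_iff_cycleType {g : Equiv.Perm α} {q : ℕ} :
    g.IsCycle ∧ #g.support = q ↔ g.cycleType = {q} := by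
  constructor
  · rintro ⟨hg, rfl⟩
    exact hg.cycleType
  · intro h
    have hg : g.IsCycle := by simp [← Equiv.Perm.card_cycleType_eq_one, h]
    exact ⟨hg, by simp [← Equiv.Perm.sum_cycleType, h]⟩

open scoped Classical in
theorem card_cycles_support_subset_mul {q : ℕ} (hq : 2 ≤ q) (A : Finset α) :
    #{g : Equiv.Perm α | (g.IsCycle ∧ #g.support = q) ∧ g.support ⊆ A} * q =
      (#A).descFactorial q := by
  have hcard : #{g : Equiv.Perm α | (g.IsCycle ∧ #g.support = q) ∧ g.support ⊆ A} =
      #{g : Equiv.Perm A | g.cycleType = {q}} := by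
    refine (card_bij (fun g _ => (permEquivSupportSubset A g : Equiv.Perm α)) ?_ ?_ ?_).symm
    · intro g hg
      rw [mem_filter, isCycle_and_card_support_iff_cycleType]
      refine ⟨mem_univ _, ?_, (permEquivSupportSubset A g).2⟩
      exact Equiv.Perm.cycleType_ofSubtype.trans (mem_filter.1 hg).2
    · intro g _ h _ hgh
      exact (permEquivSupportSubset A).injective (Subtype.ext hgh)
    · intro g hg
      rw [mem_filter, isCycle_and_card_support_iff_cycleType] at hg
      obtain ⟨h, hh⟩ := (permEquivSupportSubset A).surjective ⟨g, hg.2.2⟩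
      have hh' : Equiv.Perm.ofSubtype h = g := congrArg Subtype.val hh
      refine ⟨h, ?_, hh'⟩
      rw [mem_filter, ← Equiv.Perm.cycleType_ofSubtype, hh']
      exact ⟨mem_univ _, hg.2.1⟩
  rw [hcard]
  rcases lt_or_ge (#A) q with h | h
  · rw [Nat.descFactorial_eq_zero_iff_lt.2 h, Finset.card_eq_zero.2, zero_mul]
    refine filter_eq_empty_iff.2 fun g _ hg => ?_
    have := g.sum_cycleType_le
    rw [hg] at this
    simp at this
    omega
  · rw [Equiv.Perm.card_of_cycleType_singleton hq (by simpa using h), Fintype.card_coe,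
      Nat.descFactorial_eq_factorial_mul_choose, ← Nat.mul_factorial_pred (by omega : q ≠ 0)]
    ring

theorem finite_sparseCycleLists (q m : ℕ) (A : Finset α) : (sparseCycleLists q m A).Finite :=
  (List.finite_length_eq _ (2 * m)).subset fun _ hl => hl.1

open scoped Classical in
/-- Choosing a cycle `c`, a position, and a shorter list avoiding the support of `c` is the same
as choosing a longer list: `c` is put in front and `c⁻¹` inserted at the given position. -/
theorem card_sparseCycleLists_succ {q : ℕ} (hq : 2 ≤ q) (m : ℕ) (A : Finset α) :
    Nat.card (sparseCycleLists q (m + 1) A) =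
      (2 * m + 1) * ∑ c : Equiv.Perm α with (c.IsCycle ∧ #c.support = q) ∧ c.support ⊆ A,
        Nat.card (sparseCycleLists q m (A \ c.support)) := by
  have hfin (c : Equiv.Perm α) : Finite (sparseCycleLists q m (A \ c.support)) :=
    finite_sparseCycleLists _ _ _
  set C : Finset (Equiv.Perm α) := {c | (c.IsCycle ∧ #c.support = q) ∧ c.support ⊆ A} with hC
  have hmem (c : Equiv.Perm α) :
      c ∈ C ↔ (c.IsCycle ∧ #c.support = q) ∧ c.support ⊆ A := by simp [hC]
  let F : Fin (2 * m + 1) × (Σ c : C, sparseCycleLists q m (A \ c.1.support)) →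
      sparseCycleLists q (m + 1) A := fun p =>
    ⟨p.2.1.1 :: (p.2.2.1.take p.1 ++ p.2.1.1⁻¹ :: p.2.2.1.drop p.1),
      insert_pair_mem_sparseCycleLists ((hmem _).1 p.2.1.2).1 ((hmem _).1 p.2.1.2).2 (by
        rw [List.take_append_drop]; exact p.2.2.2)⟩
  have hnot (c : C) (l : List (Equiv.Perm α)) (hl : l ∈ sparseCycleLists q m (A \ c.1.support)) :
      c.1⁻¹ ∉ l := by
    intro hcl
    have h1 := (hl.2.1 _ hcl).2
    rw [Equiv.Perm.support_inv] at h1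
    have h2 : c.1.support = ∅ := by
      rw [eq_empty_iff_forall_notMem]
      exact fun x hx => (mem_sdiff.1 (h1 hx)).2 hx
    have h3 := ((hmem _).1 c.2).1.2
    rw [h2, card_empty] at h3
    omega
  have hF : Function.Bijective F := by
    constructor
    · rintro ⟨i, c, l, hl⟩ ⟨j, d, k, hk⟩ h
      have h' := congrArg Subtype.val h
      simp only [F, List.cons.injEq] at h'
      obtain ⟨hcd, h'⟩ := h'
      obtain rfl : c = d := Subtype.ext hcd
      rw [List.append_cons_inj_of_notMem
        (fun hx => hnot c l hl (List.mem_of_mem_take hx))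
        (fun hx => hnot c l hl (List.mem_of_mem_drop hx))] at h'
      obtain ⟨ht, -, hd⟩ := h'
      have hlk : l = k := by
        rw [← List.take_append_drop i l, ht, hd, List.take_append_drop]
      subst hlk
      have hij := congrArg List.length ht
      rw [List.length_take, List.length_take, hl.1] at hij
      have : i = j := Fin.ext (by omega)
      rw [this]
    · rintro ⟨l, hl⟩
      obtain _ | ⟨c, R⟩ := l
      · have := hl.1
        simp at this
      obtain ⟨T, D, rfl, hTD⟩ := exists_pair_of_mem_sparseCycleLists hl
      have hlen := hTD.1
      rw [List.length_append] at hlen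
      refine ⟨⟨⟨T.length, by omega⟩, ⟨c, (hmem c).2 (hl.2.1 c List.mem_cons_self)⟩, ⟨T ++ D, hTD⟩⟩, ?_⟩
      simp [F]
  rw [← Nat.card_eq_of_bijective F hF, Nat.card_prod, Nat.card_fin, Nat.card_sigma]
  rw [sum_coe_sort C fun c => Nat.card (sparseCycleLists q m (A \ c.support))]

open scoped Classical in
theorem card_sparseCycleLists_mul_pow {q : ℕ} (hq : 2 ≤ q) (m : ℕ) (A : Finset α) :
    Nat.card (sparseCycleLists q m A) * q ^ m =
      (2 * m - 1).doubleFactorial * (#A).descFactorial (q * m) := by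
  induction m generalizing A with
  | zero =>
    have : sparseCycleLists q 0 A = {[]} := by
      ext l
      constructor
      · intro hl
        simpa using hl.1
      · rintro rfl
        simp [sparseCycleLists]
    simp [this]
  | succ m ih =>
    rw [card_sparseCycleLists_succ hq, pow_succ, mul_assoc, ← mul_assoc (∑ c ∈ _, _), sum_mul]
    have hterm : ∀ c ∈ ({c | (c.IsCycle ∧ #c.support = q) ∧ c.support ⊆ A} :
        Finset (Equiv.Perm α)),
        Nat.card (sparseCycleLists q m (A \ c.support)) * q ^ m =
          (2 * m - 1).doubleFactorial * (#A - q).descFactorial (q * m) := by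
      intro c hc
      rw [mem_filter] at hc
      rw [ih, card_sdiff_of_subset hc.2.2, hc.2.1.2]
    rw [sum_congr rfl hterm, sum_const, smul_eq_mul, mul_right_comm (#_),
      card_cycles_support_subset_mul hq,
      ← Nat.descFactorial_mul_descFactorial (show q ≤ q * (m + 1) by nlinarith),
      show q * (m + 1) - q = q * m by rw [mul_add_one]; omega]
    have hdf : (2 * (m + 1) - 1).doubleFactorial =
        (2 * m + 1) * (2 * m - 1).doubleFactorial := by
      cases m with
      | zero => simp
      | succ k => exact Nat.doubleFactorial_add_two (2 * k + 1)
    rw [hdf]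
    ring

theorem prod_apply_ne_self_of_countP_eq_one {α : Type*} [DecidableEq α] {y : α}
    {l : List (Equiv.Perm α)} (h : l.countP (fun g => g y ≠ y) = 1) : l.prod y ≠ y := by
  induction l with
  | nil => simp at h
  | cons r R ih =>
    rw [List.prod_cons, Equiv.Perm.mul_apply]
    by_cases hr : r y = y
    · rw [List.countP_cons_of_neg (by simpa using hr)] at h
      intro hy
      exact ih h (r.injective (hy.trans hr.symm))
    · rw [List.countP_cons_of_pos (by simpa using hr), Nat.add_eq_right,
        List.countP_eq_zero] at h
      rwa [prod_apply_eq_self_of_forall fun g hg => by simpa using h g hg]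

theorem countP_ofFn_eq_card_filter {β : Type*} {k : ℕ} (t : Fin k → β) (p : β → Prop)
    [DecidablePred p] : (List.ofFn t).countP (fun b => p b) = #{j | p (t j)} := by
  rw [List.ofFn_eq_map, List.countP_map, List.countP_eq_length_filter]
  rfl

/-- Tuples of `q`-cycles with product `1` in which some point is moved by more than two entries
move few points in total. -/
theorem card_biUnion_support_lt {q m : ℕ} {t : Fin (2 * m) → Equiv.Perm α}
    (ht : ∀ j, #(t j).support = q) (hprod : (List.ofFn t).prod = 1)
    {x : α} (hx : 2 < #{j | t j x ≠ x}) :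
    #(univ.biUnion fun j => (t j).support) < q * m := by
  set U := univ.biUnion fun j => (t j).support with hU
  have hmem (y : α) : y ∈ U ↔ ∃ j, t j y ≠ y := by simp [hU]
  have hsum : ∑ y ∈ U, #{j | t j y ≠ y} = 2 * m * q := by
    calc ∑ y ∈ U, #{j | t j y ≠ y} = ∑ j : Fin (2 * m), #{y ∈ U | t j y ≠ y} :=
          sum_card_bipartiteAbove_eq_sum_card_bipartiteBelow fun y j => t j y ≠ y
      _ = ∑ j : Fin (2 * m), q := by
          refine sum_congr rfl fun j _ => ?_
          rw [← ht j]
          congr 1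
          ext y
          simp only [mem_filter, hmem, Equiv.Perm.mem_support, and_iff_right_iff_imp]
          exact fun h => ⟨j, h⟩
      _ = 2 * m * q := by simp
  have htwo : ∀ y ∈ U, 2 ≤ #{j | t j y ≠ y} := by
    intro y hy
    have hpos : 0 < #{j | t j y ≠ y} := by
      obtain ⟨j, hj⟩ := (hmem y).1 hy
      exact card_pos.2 ⟨j, by simpa using hj⟩
    have hone : #{j | t j y ≠ y} ≠ 1 := by
      intro h
      rw [← countP_ofFn_eq_card_filter t fun g => g y ≠ y] at h
      exact prod_apply_ne_self_of_countP_eq_one h (by simp [hprod])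
    omega
  have hxU : x ∈ U := by
    obtain ⟨j, hj⟩ := card_pos.1 (by omega : 0 < #{j | t j x ≠ x})
    exact (hmem x).2 ⟨j, by simpa using hj⟩
  have hlt : ∑ _y ∈ U, 2 < ∑ y ∈ U, #{j | t j y ≠ y} := sum_lt_sum htwo ⟨x, hxU, hx⟩
  rw [hsum, sum_const, smul_eq_mul] at hlt
  nlinarith

/-- The number of tuples of permutations that jointly move at most `d` points. -/
theorem card_biUnion_support_le_card_le (k d : ℕ) (hd : d ≤ Fintype.card α) :
    #{t : Fin k → Equiv.Perm α | #(univ.biUnion fun j => (t j).support) ≤ d} ≤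
      Fintype.card α ^ d * d.factorial ^ k := by
  calc _ ≤ #((univ.powersetCard d).biUnion fun U : Finset α =>
          Fintype.piFinset fun _ : Fin k => {g : Equiv.Perm α | g.support ⊆ U}) := by
        refine card_le_card fun t ht => ?_
        obtain ⟨U, hU, hcard⟩ := exists_superset_card_eq (mem_filter.1 ht).2 hd
        simp only [mem_biUnion, mem_powersetCard, Fintype.mem_piFinset, mem_filter, mem_univ,
          true_and]
        exact ⟨U, ⟨subset_univ _, hcard⟩, fun j => (subset_biUnion_of_mem
          (fun j => (t j).support) (mem_univ j)).trans hU⟩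
    _ ≤ #(univ.powersetCard d : Finset (Finset α)) * d.factorial ^ k := by
        refine card_biUnion_le_card_mul _ _ _ fun U hU => ?_
        rw [Fintype.card_piFinset_const, card_perm_support_subset, (mem_powersetCard.1 hU).2]
    _ ≤ _ := by
        rw [card_powersetCard, card_univ]
        exact Nat.mul_le_mul_right _ (Nat.choose_le_pow _ _)

/-- The tuples of `q`-cycles with product `1`, as a set of functions. -/
def cycleTuples (α : Type*) [Fintype α] [DecidableEq α] (q k : ℕ) :
    Set (Fin k → Equiv.Perm α) :=
  {t | (∀ j, (t j).IsCycle ∧ #(t j).support = q) ∧ (List.ofFn t).prod = 1}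

theorem card_sparse_cycleTuples (q m : ℕ) :
    (cycleTuples α q (2 * m) ∩ {t | ∀ x, #{j | t j x ≠ x} ≤ 2}).ncard =
      Nat.card (sparseCycleLists q m (univ : Finset α)) := by
  rw [Nat.card_coe_set_eq, ← Set.ncard_image_of_injective _ List.ofFn_injective]
  congr 1
  ext l
  constructor
  · rintro ⟨t, ⟨⟨hcyc, hprod⟩, hcount⟩, rfl⟩
    refine ⟨by simp, ?_, hprod, fun x => ?_⟩
    · intro g hg
      obtain ⟨j, rfl⟩ := (List.mem_ofFn' _ _).1 hg
      exact ⟨hcyc j, subset_univ _⟩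
    · rw [countP_ofFn_eq_card_filter t fun g => g x ≠ x]
      exact hcount x
  · rintro ⟨hlen, hcyc, hprod, hcount⟩
    have hl : List.ofFn (fun j : Fin (2 * m) => l[j]) = l := by
      apply List.ext_getElem <;> simp [hlen]
    refine ⟨fun j => l[j], ⟨⟨fun j => (hcyc _ (List.getElem_mem _)).1, by rw [hl, hprod]⟩,
      fun x => ?_⟩, hl⟩
    have h := countP_ofFn_eq_card_filter (fun j : Fin (2 * m) => l[j])
      fun g : Equiv.Perm α => g x ≠ x
    rw [hl] at h
    exact h.symm.trans_le (hcount x)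

theorem card_nonsparse_cycleTuples_le {q m : ℕ} (hqm : 0 < q * m)
    (hcard : q * m ≤ Fintype.card α) :
    (cycleTuples α q (2 * m) \ {t | ∀ x, #{j | t j x ≠ x} ≤ 2}).ncard ≤
      Fintype.card α ^ (q * m - 1) * (q * m - 1).factorial ^ (2 * m) := by
  refine le_trans ?_ (card_biUnion_support_le_card_le (2 * m) (q * m - 1) (by omega))
  rw [← Set.ncard_coe_finset]
  refine Set.ncard_le_ncard ?_ (Set.toFinite _)
  rintro t ⟨⟨hcyc, hprod⟩, hx⟩
  simp only [Set.mem_ofPred_eq, not_forall, not_le] at hx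
  obtain ⟨x, hx⟩ := hx
  have := card_biUnion_support_lt (fun j => (hcyc j).2) hprod hx
  simp only [coe_filter, mem_univ, true_and, Set.mem_ofPred_eq]
  omega

end

open Filter Topology Asymptotics in
theorem tendsto_descFactorial_div_pow (k : ℕ) :
    Tendsto (fun n : ℕ => (n.descFactorial k : ℝ) / (n : ℝ) ^ k) atTop (𝓝 1) := by
  refine (isEquivalent_iff_tendsto_one ?_).1 (isEquivalent_descFactorial k)
  filter_upwards [eventually_gt_atTop 0] with n hn
  positivity

/-- For fixed `q ≥ 2` and even `k = 2m`, if `B n` is the number of `2m`-tuples of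
`q`-cycles in `S_n` whose product is the identity, then
`B n · (q/n^q)^m → (2m-1)!!` as `n → ∞`. -/
theorem clt_even_moment_qcycles (q m : ℕ) (hq : 2 ≤ q) :
    Filter.Tendsto
      (fun n : ℕ =>
        (Nat.card {t : Fin (2 * m) → Equiv.Perm (Fin n) //
            (∀ j, (t j).IsCycle ∧ (t j).support.card = q) ∧
            (List.ofFn t).prod = 1} : ℝ) *
          ((q : ℝ) / (n : ℝ) ^ q) ^ m)
      Filter.atTop (nhds (Nat.doubleFactorial (2 * m - 1) : ℝ)) := by
  let S (n : ℕ) : Set (Fin (2 * m) → Equiv.Perm (Fin n)) := {t | ∀ x, #{j | t j x ≠ x} ≤ 2}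
  have hsplit (n : ℕ) : (Nat.card {t : Fin (2 * m) → Equiv.Perm (Fin n) //
      (∀ j, (t j).IsCycle ∧ (t j).support.card = q) ∧ (List.ofFn t).prod = 1} : ℝ) =
        ((cycleTuples (Fin n) q (2 * m) ∩ S n).ncard : ℝ) +
        ((cycleTuples (Fin n) q (2 * m) \ S n).ncard : ℝ) := by
    rw [← Nat.cast_add, Set.ncard_inter_add_ncard_sdiff_eq_ncard _ _ (Set.toFinite _)]
    rfl
  simp only [hsplit, add_mul]
  rw [← add_zero ((2 * m - 1).doubleFactorial : ℝ)]
  refine Filter.Tendsto.add ?_ ?_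
  · rw [← mul_one ((2 * m - 1).doubleFactorial : ℝ)]
    refine ((tendsto_descFactorial_div_pow (q * m)).const_mul _).congr fun n => ?_
    have h := card_sparseCycleLists_mul_pow hq m (univ : Finset (Fin n))
    rw [card_univ, Fintype.card_fin] at h
    rw [card_sparse_cycleTuples, div_pow, ← mul_div_assoc, ← mul_div_assoc, ← pow_mul]
    congr 1
    exact_mod_cast h.symm
  · rcases Nat.eq_zero_or_pos m with rfl | hm
    · refine tendsto_const_nhds.congr fun n => ?_
      rw [show cycleTuples (Fin n) q (2 * 0) \ S n = ∅ by
        rw [Set.sdiff_eq_empty]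
        exact fun t _ x => by simp]
      simp
    · have hqm : 0 < q * m := by positivity
      have hlim : Filter.Tendsto (fun n : ℕ =>
          ((q * m - 1).factorial : ℝ) ^ (2 * m) * (q : ℝ) ^ m / (n : ℝ))
          Filter.atTop (nhds 0) := tendsto_const_div_atTop_nhds_zero_nat _
      refine squeeze_zero' (Filter.Eventually.of_forall fun n => by positivity) ?_ hlim
      filter_upwards [Filter.eventually_ge_atTop (q * m)] with n hn
      have hle := card_nonsparse_cycleTuples_le (α := Fin n) hqm (by simpa using hn)
      rw [Fintype.card_fin] at hle
      have hn0 : (n : ℝ) ≠ 0 := by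
        have : n ≠ 0 := by omega
        exact_mod_cast this
      calc _ ≤ ((n ^ (q * m - 1) * (q * m - 1).factorial ^ (2 * m) : ℕ) : ℝ) *
            ((q : ℝ) / (n : ℝ) ^ q) ^ m := by gcongr
        _ = _ := by
          rw [div_pow, ← pow_mul]
          obtain ⟨d, hd⟩ : ∃ d, q * m = d + 1 := ⟨q * m - 1, by omega⟩
          rw [hd, Nat.add_sub_cancel]
          push_cast
          field_simp
          rw [pow_succ]
end
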